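/- arXiv:0707.4632 — 2 statements merged into one kernel-verified Lean document; each statement's English description precedes it below -/
import Mathlib

section
/- Let q : ℝ → ℝ be continuous with ∫_a^∞ (1 + t²)·|q(t)| dt < ∞ for every a ∈ ℝ and set Q(x) = ∫_{x/2}^∞ |q(t)| dt. Let K : {(x,y) : y ≥ x} → ℝ be continuously differentiable with |K(x,y)| ≤ C(x)·Q(x+y) and |∂K/∂x (x,y)| + |∂K/∂y (x,y)| ≤ C(x)·( |q((x+y)/2)| + Q(x+y) ) for some positive continuous nonincreasing C, and assume x ↦ K(x,x) is continuously differentiable with ∫_a^∞ (1 + x²)·|d/dx K(x,x)| dx < ∞ for every a ∈ ℝ. Let F : ℝ² → ℝ be symmetric (F(x,y) = F(y,x)) with continuous first-order partial derivatives, satisfy |F(x,y)| ≤ C₁(x)·Q(x+y) and |∂F/∂x (x,y)| + |∂F/∂y (x,y)| ≤ C₁(x)·( |q((x+y)/2)| + Q(x+y) ) for y ≥ x with C₁ positive continuous nonincreasing, and satisfy the GLM equation K(x,y) + F(x,y) + ∫_x^∞ K(x,t)·F(t,y) dt = 0 for all y ≥ x. Then x ↦ F(x,x) is continuously differentiable and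 ∫_a^∞ (1 + x²)·|d/dx F(x,x)| dx < ∞ for every a ∈ ℝ. -/
open MeasureTheory Filter

/-- `Q(x) = ∫_{x/2}^∞ |q(t)| dt`. -/
noncomputable def Qfun (q : ℝ → ℝ) (x : ℝ) : ℝ := ∫ t in Set.Ioi (x / 2), |q t|

section

open Set

/-- Translation and dilation of an integrable function on a right half-line. -/
theorem integrableOn_Ioi_comp_midpoint {f : ℝ → ℝ} (ξ a : ℝ)
    (hf : IntegrableOn f (Ioi ((ξ + a) / 2))) :
    IntegrableOn (fun t => f ((ξ + t) / 2)) (Ioi a) ∧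
      ∫ t in Ioi a, f ((ξ + t) / 2) = 2 * ∫ t in Ioi ((ξ + a) / 2), f t := by
  have hmp := measurePreserving_add_left (volume : Measure ℝ) (ξ / 2)
  have hemb := measurableEmbedding_addLeft (ξ / 2)
  have hpre : (fun u => ξ / 2 + u) ⁻¹' Ioi ((ξ + a) / 2) = Ioi (2⁻¹ * a) := by
    ext u
    simp only [mem_preimage, mem_Ioi]
    constructor <;> intro h <;> linarith
  have hfun : (fun t => f ((ξ + t) / 2)) = fun t => (fun u => f (ξ / 2 + u)) (2⁻¹ * t) := by
    funext t
    congr 1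
    ring
  rw [hfun]
  constructor
  · rw [integrableOn_Ioi_comp_mul_left_iff (fun u => f (ξ / 2 + u)) a (by norm_num : (0:ℝ) < 2⁻¹),
      ← hpre]
    exact (hmp.integrableOn_comp_preimage hemb).2 hf
  · rw [integral_comp_mul_left_Ioi (fun u => f (ξ / 2 + u)) a (by norm_num : (0:ℝ) < 2⁻¹),
      ← hpre, hmp.setIntegral_preimage_emb hemb, inv_inv, smul_eq_mul]

theorem continuous_integral_Ioi {f : ℝ → ℝ} (hf : ∀ a, IntegrableOn f (Ioi a)) :
    Continuous fun x => ∫ t in Ioi x, f t := by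
  have hint : ∀ a b, IntervalIntegrable f volume a b := fun a b => by
    rw [intervalIntegrable_iff]
    exact (hf (min a b)).mono_set fun t ht => ht.1
  have heq : (fun x => ∫ t in Ioi x, f t) =
      fun x => (∫ t in Ioi 0, f t) - ∫ t in (0 : ℝ)..x, f t := by
    funext x
    rw [← intervalIntegral.integral_Ioi_sub_Ioi' (hf 0) (hf x)]
    ring
  rw [heq]
  exact continuous_const.sub (intervalIntegral.continuous_primitive hint 0)

theorem integral_Ioi_antitone {f : ℝ → ℝ} (hf : ∀ a, IntegrableOn f (Ioi a))
    (hf0 : ∀ x, 0 ≤ f x) : Antitone fun x => ∫ t in Ioi x, f t := fun x _ hxy =>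
  setIntegral_mono_set (hf x) (Eventually.of_forall hf0) (Ioi_subset_Ioi hxy).eventuallyLE

/-- A function with a finite first moment has an integrable tail integral. -/
theorem integrableOn_integral_Ioi {f : ℝ → ℝ} (hf : Continuous f) {a : ℝ}
    (h : IntegrableOn (fun t => (t - a) * f t) (Ioi a)) :
    IntegrableOn (fun x => ∫ t in Ioi x, f t) (Ioi a) := by
  set μ : Measure ℝ := volume.restrict (Ioi a) with hμ
  let g : ℝ × ℝ → ℝ := {p : ℝ × ℝ | p.1 < p.2}.indicator fun p => f p.2
  have hset : MeasurableSet {p : ℝ × ℝ | p.1 < p.2} := measurableSet_lt measurable_fst measurable_snd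
  have hgm : AEStronglyMeasurable g (μ.prod μ) :=
    ((hf.comp continuous_snd).stronglyMeasurable.indicator hset).aestronglyMeasurable
  have hslice : ∀ t, (fun x => g (x, t)) = (Iio t).indicator fun _ => f t := by
    intro t
    funext x
    simp [g, indicator]
  have hvol : ∀ t, μ (Iio t) = ENNReal.ofReal (t - a) := by
    intro t
    rw [hμ, Measure.restrict_apply measurableSet_Iio, inter_comm, Ioi_inter_Iio, Real.volume_Ioo]
  have hg : Integrable g (μ.prod μ) := by
    rw [integrable_prod_iff' hgm]
    constructor
    · refine Eventually.of_forall fun t => ?_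
      rw [hslice, integrable_indicator_iff measurableSet_Iio]
      refine integrableOn_const (by rw [hvol]; exact ENNReal.ofReal_ne_top)
    · refine h.norm.congr ?_
      filter_upwards [ae_restrict_mem measurableSet_Ioi] with t ht
      have hnorm : (fun x => ‖g (x, t)‖) = (Iio t).indicator fun _ => ‖f t‖ := by
        funext x
        rw [congrFun (hslice t) x, norm_indicator_eq_indicator_norm]
      have hta : 0 ≤ t - a := (sub_pos.2 ht).le
      rw [hnorm, integral_indicator measurableSet_Iio, setIntegral_const, Measure.real, hvol,
        ENNReal.toReal_ofReal hta, norm_mul, Real.norm_of_nonneg hta, smul_eq_mul]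
  refine hg.integral_prod_left.congr ?_
  filter_upwards [ae_restrict_mem measurableSet_Ioi] with x hx
  have hx' : (fun t => g (x, t)) = (Ioi x).indicator f := by
    funext t
    simp [g, indicator]
  rw [hx', integral_indicator measurableSet_Ioi, hμ, Measure.restrict_restrict measurableSet_Ioi,
    inter_eq_left.2 (Ioi_subset_Ioi (le_of_lt hx))]

theorem abs_sub_le_integral_of_hasDerivWithinAt_Iic {f f' b : ℝ → ℝ} {x x' t : ℝ}
    (hxx' : x ≤ x') (hx't : x' ≤ t) (hb : Continuous b)
    (hf : ∀ ξ ∈ Icc x x', HasDerivWithinAt f (f' ξ) (Iic t) ξ)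
    (hbound : ∀ ξ ∈ Icc x x', |f' ξ| ≤ b ξ) :
    |f x' - f x| ≤ ∫ ξ in x..x', b ξ := by
  refine image_norm_le_of_norm_deriv_right_le_deriv_boundary (f := fun ξ => f ξ - f x) (f' := f')
    (B := fun u => ∫ ξ in x..u, b ξ) (B' := b) (a := x) (b := x') ?_ ?_ ?_ ?_ ?_
    (right_mem_Icc.2 hxx')
  · exact ContinuousOn.sub (fun ξ hξ => ((hf ξ hξ).continuousWithinAt).mono
      fun u hu => hu.2.trans hx't) continuousOn_const
  · intro ξ hξ
    have := (hf ξ (Ico_subset_Icc_self hξ)).hasDerivAt (Iic_mem_nhds (hξ.2.trans_le hx't))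
    exact (this.sub_const (f x)).hasDerivWithinAt
  · simp
  · exact fun u => hb.integral_hasStrictDerivAt x u |>.hasDerivAt
  · exact fun ξ hξ => hbound ξ (Ico_subset_Icc_self hξ)

theorem integral_Ioi_intervalIntegral_midpoint_le {p : ℝ → ℝ} (hp : Continuous p)
    (hp0 : ∀ x, 0 ≤ p x) (hpi : ∀ a, IntegrableOn p (Ioi a)) {x x' : ℝ} (hxx' : x ≤ x') :
    IntegrableOn (fun t => ∫ ξ in x..x', p ((ξ + t) / 2)) (Ioi x') ∧
      ∫ t in Ioi x', ∫ ξ in x..x', p ((ξ + t) / 2) ≤ (x' - x) * (2 * ∫ t in Ioi x, p t) := by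
  have hslice := fun ξ => integrableOn_Ioi_comp_midpoint ξ x' (hpi ((ξ + x') / 2))
  have hcont : Continuous fun ξ => 2 * ∫ t in Ioi ((ξ + x') / 2), p t :=
    continuous_const.mul ((continuous_integral_Ioi hpi).comp (by fun_prop))
  have hprod : Integrable (Function.uncurry fun ξ t => p ((ξ + t) / 2))
      ((volume.restrict (uIoc x x')).prod (volume.restrict (Ioi x'))) := by
    have hc : Continuous (Function.uncurry fun ξ t => p ((ξ + t) / 2)) := by
      unfold Function.uncurry
      fun_prop
    rw [integrable_prod_iff hc.aestronglyMeasurable]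
    refine ⟨Eventually.of_forall fun ξ => (hslice ξ).1, ?_⟩
    simp only [Function.uncurry, Real.norm_of_nonneg (hp0 _), (hslice _).2]
    exact (intervalIntegrable_iff.1 (hcont.intervalIntegrable x x'))
  constructor
  · have := hprod.integral_prod_right
    simp only [Function.uncurry, uIoc_of_le hxx'] at this
    simpa only [intervalIntegral.integral_of_le hxx', IntegrableOn] using this
  · rw [← intervalIntegral_integral_swap hprod]
    simp only [(hslice _).2]
    calc ∫ ξ in x..x', 2 * ∫ t in Ioi ((ξ + x') / 2), p t
        ≤ ∫ _ in x..x', 2 * ∫ t in Ioi x, p t := by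
          refine intervalIntegral.integral_mono_on hxx' (hcont.intervalIntegrable _ _)
            intervalIntegrable_const fun ξ hξ => ?_
          have := integral_Ioi_antitone hpi hp0 (show x ≤ (ξ + x') / 2 by linarith [hξ.1])
          simpa using this
      _ = _ := by
          rw [intervalIntegral.integral_const, smul_eq_mul]

/-- A kernel on `{y ≥ x}` whose size and first partial derivative are controlled by functions
of `(x + y) / 2`, up to a nonincreasing factor in `x`. -/
structure IsControlledKernel (A A₁ : ℝ → ℝ → ℝ) (C P p : ℝ → ℝ) : Prop where
  antitone : Antitone C
  pos : ∀ x, 0 < C x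
  continuousOn : ∀ x, ContinuousOn (A x) (Ici x)
  hasDerivWithinAt : ∀ x y, x ≤ y → HasDerivWithinAt (fun x' => A x' y) (A₁ x y) (Iic y) x
  bound : ∀ x y, x ≤ y → |A x y| ≤ C x * P ((x + y) / 2)
  deriv_bound : ∀ x y, x ≤ y → |A₁ x y| ≤ C x * p ((x + y) / 2)

namespace IsControlledKernel

variable {A A₁ B B₁ : ℝ → ℝ → ℝ} {C D P p : ℝ → ℝ}

theorem bound_of_le (hA : IsControlledKernel A A₁ C P p) (hP : Antitone P) (hP0 : ∀ x, 0 ≤ P x)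
    {x y t : ℝ} (hxy : x ≤ y) (hyt : y ≤ t) : |A y t| ≤ C x * P x := by
  refine (hA.bound y t hyt).trans ?_
  exact mul_le_mul (hA.antitone hxy) (hP (by linarith)) (hP0 _) (hA.pos x).le

theorem abs_sub_le (hA : IsControlledKernel A A₁ C P p) (hp : Continuous p) (hp0 : ∀ x, 0 ≤ p x)
    {x x' t : ℝ} (hxx' : x ≤ x') (hx't : x' ≤ t) :
    |A x' t - A x t| ≤ C x * ∫ ξ in x..x', p ((ξ + t) / 2) := by
  rw [← intervalIntegral.integral_const_mul]
  refine abs_sub_le_integral_of_hasDerivWithinAt_Iic (f := fun ξ => A ξ t) (f' := fun ξ => A₁ ξ t)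
    hxx' hx't (by fun_prop) (fun ξ hξ => hA.hasDerivWithinAt ξ t (hξ.2.trans hx't)) fun ξ hξ => ?_
  exact (hA.deriv_bound ξ t (hξ.2.trans hx't)).trans
    (mul_le_mul_of_nonneg_right (hA.antitone hξ.1) (hp0 _))

theorem integrableOn_mul (hA : IsControlledKernel A A₁ C P p) (hB : IsControlledKernel B B₁ D P p)
    (hP : Antitone P) (hP0 : ∀ x, 0 ≤ P x) (hPi : ∀ a, IntegrableOn P (Ioi a)) (x : ℝ) :
    IntegrableOn (fun t => A x t * B x t) (Ioi x) := by
  have hsub : Ioi x ⊆ Ici x := Ioi_subset_Ici_self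
  refine Integrable.mono' (((integrableOn_Ioi_comp_midpoint x x (hPi _)).1.const_mul (C x)).mul_const
    (D x * P x)) ?_ ?_
  · exact (((hA.continuousOn x).mul (hB.continuousOn x)).mono hsub).aestronglyMeasurable
      measurableSet_Ioi
  · filter_upwards [ae_restrict_mem measurableSet_Ioi] with t ht
    rw [Real.norm_eq_abs, abs_mul]
    exact mul_le_mul (hA.bound x t (le_of_lt ht)) (hB.bound_of_le hP hP0 le_rfl (le_of_lt ht))
      (abs_nonneg _) (mul_nonneg (hA.pos x).le (hP0 _))

theorem abs_integral_sub_le (hA : IsControlledKernel A A₁ C P p)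
    (hB : IsControlledKernel B B₁ D P p)
    (hP : Antitone P) (hP0 : ∀ x, 0 ≤ P x) (hPi : ∀ a, IntegrableOn P (Ioi a))
    (hp : Continuous p) (hp0 : ∀ x, 0 ≤ p x) (hpi : ∀ a, IntegrableOn p (Ioi a))
    {x x' : ℝ} (hxx' : x ≤ x') :
    |(∫ t in Ioi x', A x' t * B x' t) - ∫ t in Ioi x, A x t * B x t| ≤
      C x * D x * P x * (P x + 4 * ∫ t in Ioi x, p t) * (x' - x) := by
  have hx := hA.integrableOn_mul hB hP hP0 hPi x
  have hx' := hA.integrableOn_mul hB hP hP0 hPi x'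
  have hxt := hx.mono_set (Ioi_subset_Ioi hxx')
  obtain ⟨hWi, hW⟩ := integral_Ioi_intervalIntegral_midpoint_le hp hp0 hpi hxx'
  have hC := (hA.pos x).le
  have hD := (hB.pos x).le
  have hM : 0 ≤ C x * D x * P x := mul_nonneg (mul_nonneg hC hD) (hP0 x)
  have hnear : |∫ t in x..x', A x t * B x t| ≤ C x * P x * (D x * P x) * (x' - x) := by
    have := intervalIntegral.norm_integral_le_of_norm_le_const (a := x) (b := x')
      (f := fun t => A x t * B x t) (C := C x * P x * (D x * P x)) fun t ht => by
        rw [uIoc_of_le hxx'] at ht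
        rw [Real.norm_eq_abs, abs_mul]
        exact mul_le_mul (hA.bound_of_le hP hP0 le_rfl ht.1.le)
          (hB.bound_of_le hP hP0 le_rfl ht.1.le) (abs_nonneg _) (mul_nonneg hC (hP0 x))
    rwa [abs_of_nonneg (sub_nonneg.2 hxx'), Real.norm_eq_abs] at this
  have hfar : |∫ t in Ioi x', (A x' t * B x' t - A x t * B x t)| ≤
      2 * (C x * D x * P x) * ((x' - x) * (2 * ∫ t in Ioi x, p t)) := by
    have hle := norm_integral_le_of_norm_le (μ := volume.restrict (Ioi x'))
      (f := fun t => A x' t * B x' t - A x t * B x t)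
      (hWi.const_mul (2 * (C x * D x * P x))) (by
        filter_upwards [ae_restrict_mem measurableSet_Ioi] with t ht
        have ht' : x' ≤ t := le_of_lt ht
        have h1 := hA.abs_sub_le hp hp0 hxx' ht'
        have h2 := hB.abs_sub_le hp hp0 hxx' ht'
        have h3 := hB.bound_of_le hP hP0 hxx' ht'
        have h4 := hA.bound_of_le hP hP0 le_rfl (hxx'.trans ht')
        have hsplit : A x' t * B x' t - A x t * B x t =
            (A x' t - A x t) * B x' t + A x t * (B x' t - B x t) := by ring
        rw [Real.norm_eq_abs, hsplit]
        refine (abs_add_le _ _).trans ?_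
        rw [abs_mul, abs_mul]
        have h5 := mul_le_mul h1 h3 (abs_nonneg _) ((abs_nonneg _).trans h1)
        have h6 := mul_le_mul h4 h2 (abs_nonneg _) ((abs_nonneg _).trans h4)
        refine (add_le_add h5 h6).trans (le_of_eq ?_)
        ring)
    rw [Real.norm_eq_abs, integral_const_mul] at hle
    exact hle.trans (mul_le_mul_of_nonneg_left hW (by positivity))
  have hdecomp : (∫ t in Ioi x', A x' t * B x' t) - ∫ t in Ioi x, A x t * B x t =
      (∫ t in Ioi x', (A x' t * B x' t - A x t * B x t)) - ∫ t in x..x', A x t * B x t := by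
    rw [integral_sub hx' hxt, ← intervalIntegral.integral_Ioi_sub_Ioi hx hxx']
    ring
  rw [hdecomp]
  refine (abs_sub _ _).trans ((add_le_add hfar hnear).trans (le_of_eq ?_))
  ring

end IsControlledKernel

theorem HasDerivAt.abs_le_of_right_lipschitz {g : ℝ → ℝ} {g' x c : ℝ} (hg : HasDerivAt g g' x)
    (h : ∀ x', x ≤ x' → |g x' - g x| ≤ c * (x' - x)) : |g'| ≤ c := by
  have hlim := (hasDerivWithinAt_iff_tendsto_slope' (s := Ioi x) (lt_irrefl x)).1
    hg.hasDerivWithinAt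
  refine le_of_tendsto hlim.abs ?_
  filter_upwards [self_mem_nhdsWithin] with x' hx'
  have hpos : 0 < x' - x := sub_pos.2 hx'
  rw [slope_def_field, abs_div, abs_of_pos hpos, div_le_iff₀ hpos]
  exact h x' (le_of_lt hx')

end

/-- Estimate (A.32) of Lemma A.3: second-moment integrability of the derivative of the
diagonal of the GLM kernel `F`, given the estimates on `K`, `F`, their first-order
partial derivatives, and the second-moment integrability for the diagonal of `K`. -/
theorem glm_kernel_diagonal_estimate
    (q : ℝ → ℝ) (hq : Continuous q)
    (hmom : ∀ a : ℝ, IntegrableOn (fun t => (1 + t ^ 2) * |q t|) (Set.Ioi a))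
    (K K₁ K₂ : ℝ → ℝ → ℝ)
    (hKcont : ContinuousOn (fun p : ℝ × ℝ => K p.1 p.2) {p : ℝ × ℝ | p.1 ≤ p.2})
    (hKder : ∀ x y : ℝ, x ≤ y →
      HasDerivWithinAt (fun x' => K x' y) (K₁ x y) (Set.Iic y) x ∧
      HasDerivWithinAt (fun y' => K x y') (K₂ x y) (Set.Ici x) y)
    (C : ℝ → ℝ) (hC : Continuous C) (hCpos : ∀ x, 0 < C x) (hCanti : Antitone C)
    (hKbd : ∀ x y : ℝ, x ≤ y → |K x y| ≤ C x * Qfun q (x + y))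
    (hKdbd : ∀ x y : ℝ, x ≤ y →
      |K₁ x y| + |K₂ x y| ≤ C x * (|q ((x + y) / 2)| + Qfun q (x + y)))
    (hKdiag : ContDiff ℝ 1 fun x : ℝ => K x x)
    (hKdiagint : ∀ a : ℝ,
      IntegrableOn (fun x => (1 + x ^ 2) * |deriv (fun t : ℝ => K t t) x|) (Set.Ioi a))
    (F : ℝ → ℝ → ℝ)
    (hFdiff : ContDiff ℝ 1 fun p : ℝ × ℝ => F p.1 p.2)
    (hFsymm : ∀ x y : ℝ, F x y = F y x)
    (C₁ : ℝ → ℝ) (hC₁ : Continuous C₁) (hC₁pos : ∀ x, 0 < C₁ x) (hC₁anti : Antitone C₁)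
    (hFbd : ∀ x y : ℝ, x ≤ y → |F x y| ≤ C₁ x * Qfun q (x + y))
    (hFdbd : ∀ x y : ℝ, x ≤ y →
      |deriv (fun x' => F x' y) x| + |deriv (fun y' => F x y') y| ≤
        C₁ x * (|q ((x + y) / 2)| + Qfun q (x + y)))
    (hGLM : ∀ x y : ℝ, x ≤ y →
      K x y + F x y + ∫ t in Set.Ioi x, K x t * F t y = 0) :
    ContDiff ℝ 1 (fun x : ℝ => F x x) ∧
    ∀ a : ℝ,
      IntegrableOn (fun x => (1 + x ^ 2) * |deriv (fun t : ℝ => F t t) x|)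
        (Set.Ioi a) := by
  have hqa : Continuous fun t => |q t| := hq.abs
  have hw : ∀ a t : ℝ, (t - a) ^ 2 ≤ 2 * (1 + a ^ 2) * (1 + t ^ 2) := fun a t => by
    nlinarith [sq_nonneg (t + a), mul_nonneg (sq_nonneg a) (sq_nonneg t)]
  have hqi : ∀ a, IntegrableOn (fun t => |q t|) (Set.Ioi a) := fun a =>
    (hmom a).mono' hqa.aestronglyMeasurable (Eventually.of_forall fun t => by
      rw [Real.norm_eq_abs, abs_abs]
      nlinarith [mul_nonneg (sq_nonneg t) (abs_nonneg (q t))])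
  have hqi2 : ∀ a, IntegrableOn (fun t => (t - a) * ((t - a) * |q t|)) (Set.Ioi a) := fun a => by
    refine ((hmom a).const_mul (2 * (1 + a ^ 2))).mono'
      (Continuous.aestronglyMeasurable (by fun_prop)) ?_
    filter_upwards [ae_restrict_mem measurableSet_Ioi] with t ht
    have hq0 := abs_nonneg (q t)
    rw [Real.norm_of_nonneg (by rw [← mul_assoc]; exact mul_nonneg (mul_self_nonneg _) hq0)]
    nlinarith [mul_le_mul_of_nonneg_right (hw a t) hq0]
  have hqi1 : ∀ a, IntegrableOn (fun t => (t - a) * |q t|) (Set.Ioi a) := fun a => by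
    refine ((hqi a).add (hqi2 a)).mono' (Continuous.aestronglyMeasurable (by fun_prop)) ?_
    filter_upwards [ae_restrict_mem measurableSet_Ioi] with t ht
    have hq0 := abs_nonneg (q t)
    have hta : 0 < t - a := sub_pos.2 ht
    rw [Real.norm_of_nonneg (mul_nonneg hta.le hq0), Pi.add_apply]
    nlinarith [mul_nonneg (sq_nonneg (t - a - 1)) hq0, mul_nonneg (sq_nonneg (t - a)) hq0]
  set P : ℝ → ℝ := fun x => ∫ t in Set.Ioi x, |q t| with hPdef
  have hPc : Continuous P := continuous_integral_Ioi hqi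
  have hPanti : Antitone P := integral_Ioi_antitone hqi fun _ => abs_nonneg _
  have hP0 : ∀ x, 0 ≤ P x := fun x => integral_nonneg fun _ => abs_nonneg _
  have hPi : ∀ a, IntegrableOn P (Set.Ioi a) := fun a => integrableOn_integral_Ioi hqa (hqi1 a)
  have hPi1 : ∀ a, IntegrableOn (fun t => (t - a) * P t) (Set.Ioi a) := fun a => by
    refine (integrableOn_integral_Ioi (f := fun t => (t - a) * |q t|) (by fun_prop)
      (hqi2 a)).mono' (Continuous.aestronglyMeasurable (by fun_prop)) ?_
    filter_upwards [ae_restrict_mem measurableSet_Ioi] with t ht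
    have hta : 0 < t - a := sub_pos.2 ht
    rw [Real.norm_of_nonneg (mul_nonneg hta.le (hP0 t)), hPdef, ← integral_const_mul]
    refine setIntegral_mono_on ((hqi t).const_mul _)
      ((hqi1 a).mono_set (Set.Ioi_subset_Ioi (le_of_lt ht))) measurableSet_Ioi fun s hs => ?_
    exact mul_le_mul_of_nonneg_right (sub_le_sub_right (le_of_lt hs) a) (abs_nonneg _)
  set p : ℝ → ℝ := fun u => |q u| + P u
  have hpc : Continuous p := hqa.add hPc
  have hp0 : ∀ x, 0 ≤ p x := fun x => add_nonneg (abs_nonneg _) (hP0 x)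
  have hpi : ∀ a, IntegrableOn p (Set.Ioi a) := fun a => (hqi a).add (hPi a)
  set T : ℝ → ℝ := fun x => ∫ t in Set.Ioi x, p t
  have hTi : ∀ a, IntegrableOn T (Set.Ioi a) := fun a =>
    integrableOn_integral_Ioi hpc (((hqi1 a).add (hPi1 a)).congr
      (Eventually.of_forall fun t => (mul_add (t - a) |q t| (P t)).symm))
  have hPT : ∀ x, P x ≤ T x := fun x =>
    setIntegral_mono (hqi x) (hpi x) fun t => le_add_of_nonneg_right (hP0 t)
  have hKctrl : IsControlledKernel K K₁ C P p :=
    { antitone := hCanti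
      pos := hCpos
      continuousOn := fun x y hy =>
        ((hKder x y hy).2).continuousWithinAt
      hasDerivWithinAt := fun x y hxy => (hKder x y hxy).1
      bound := hKbd
      deriv_bound := fun x y hxy =>
        (le_add_of_nonneg_right (abs_nonneg _)).trans (hKdbd x y hxy) }
  have hFctrl : IsControlledKernel F (fun x y => deriv (fun x' => F x' y) x) C₁ P p :=
    { antitone := hC₁anti
      pos := hC₁pos
      continuousOn := fun x =>
        (hFdiff.continuous.comp (by fun_prop : Continuous fun y : ℝ => (x, y))).continuousOn
      hasDerivWithinAt := fun x y _ => by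
        have hd : Differentiable ℝ fun x' => F x' y :=
          (hFdiff.differentiable one_ne_zero).comp
            (by fun_prop : Differentiable ℝ fun x' : ℝ => (x', y))
        exact (hd x).hasDerivAt.hasDerivWithinAt
      bound := hFbd
      deriv_bound := fun x y hxy =>
        (le_add_of_nonneg_right (abs_nonneg _)).trans (hFdbd x y hxy) }
  have hFdiag : ContDiff ℝ 1 fun x : ℝ => F x x :=
    hFdiff.comp (by fun_prop : ContDiff ℝ 1 fun x : ℝ => (x, x))
  refine ⟨hFdiag, fun a => ?_⟩
  have hderiv : ∀ x, |deriv (fun t => F t t) x + deriv (fun t => K t t) x| ≤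
      C x * C₁ x * P x * (P x + 4 * T x) := by
    intro x
    have hG := (((hFdiag.differentiable one_ne_zero) x).hasDerivAt.add
      ((hKdiag.differentiable one_ne_zero) x).hasDerivAt).neg
    rw [← abs_neg]
    refine hG.abs_le_of_right_lipschitz fun x' hxx' => ?_
    have hval : ∀ y, -(F y y + K y y) = ∫ t in Set.Ioi y, K y t * F y t := fun y => by
      have h := hGLM y y le_rfl
      simp only [hFsymm _ y] at h
      linarith
    simp only [Pi.neg_apply, Pi.add_apply, hval]
    exact hKctrl.abs_integral_sub_le hFctrl hPanti hP0 hPi hpc hp0 hpi hxx'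
  set M := ∫ t in Set.Ioi a, (1 + t ^ 2) * |q t|
  have hPM : ∀ x, a < x → (1 + x ^ 2) * P x ≤ (1 + a ^ 2) * M := by
    intro x hx
    have h1 : (1 + x ^ 2) * P x ≤ ∫ t in Set.Ioi x, (1 + a ^ 2) * ((1 + t ^ 2) * |q t|) := by
      rw [hPdef, ← integral_const_mul]
      refine setIntegral_mono_on ((hqi x).const_mul _) ((hmom x).const_mul _)
        measurableSet_Ioi fun t ht => ?_
      rw [← mul_assoc]
      refine mul_le_mul_of_nonneg_right ?_ (abs_nonneg _)
      have ht' : x < t := ht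
      rcases le_total 0 x with h0 | h0
      · nlinarith [mul_nonneg (sq_nonneg a) (sq_nonneg t), sq_nonneg a]
      · nlinarith [mul_nonneg (sq_nonneg a) (sq_nonneg t), sq_nonneg t]
    rw [integral_const_mul] at h1
    refine h1.trans (mul_le_mul_of_nonneg_left ?_ (by positivity))
    exact integral_Ioi_antitone hmom (fun t => by positivity) hx.le
  have hFderc : Continuous (deriv fun t : ℝ => F t t) := hFdiag.continuous_deriv le_rfl
  refine ((hKdiagint a).add ((hTi a).const_mul
    (5 * (C a * C₁ a) * ((1 + a ^ 2) * M)))).mono'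
    (Continuous.aestronglyMeasurable (by fun_prop)) ?_
  filter_upwards [ae_restrict_mem measurableSet_Ioi] with x hx
  have hx' : a < x := hx
  have hT0 : 0 ≤ T x := (hP0 x).trans (hPT x)
  have hCC : C x * C₁ x ≤ C a * C₁ a :=
    mul_le_mul (hCanti hx'.le) (hC₁anti hx'.le) (hC₁pos x).le (hCpos a).le
  have hCC0 : 0 ≤ C a * C₁ a := (mul_pos (hCpos a) (hC₁pos a)).le
  have h1 : |deriv (fun t => F t t) x + deriv (fun t => K t t) x| ≤
      C a * C₁ a * P x * (5 * T x) := by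
    refine (hderiv x).trans (mul_le_mul (mul_le_mul_of_nonneg_right hCC (hP0 x)) ?_ ?_ ?_)
    · linarith [hPT x]
    · linarith [hP0 x]
    · exact mul_nonneg hCC0 (hP0 x)
  have h2 : |deriv (fun t => F t t) x| ≤
      |deriv (fun t => K t t) x| + C a * C₁ a * P x * (5 * T x) := by
    have := abs_sub (deriv (fun t => F t t) x + deriv (fun t => K t t) x)
      (deriv (fun t => K t t) x)
    rw [add_sub_cancel_right] at this
    linarith
  rw [Real.norm_of_nonneg (by positivity), Pi.add_apply]
  calc (1 + x ^ 2) * |deriv (fun t => F t t) x|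
      ≤ (1 + x ^ 2) * (|deriv (fun t => K t t) x| + C a * C₁ a * P x * (5 * T x)) :=
        mul_le_mul_of_nonneg_left h2 (by positivity)
    _ = (1 + x ^ 2) * |deriv (fun t => K t t) x| +
          5 * (C a * C₁ a) * ((1 + x ^ 2) * P x) * T x := by ring
    _ ≤ _ := by
        refine add_le_add_right (mul_le_mul_of_nonneg_right
          (mul_le_mul_of_nonneg_left (hPM x hx') (by positivity)) hT0) _
end

section
/- Let p, q̃ : ℝ → ℝ be continuous and let K be a real-valued twice continuously differentiable function on {(x,y) : y ≥ x} satisfying: (i) ∂²K/∂x²(x,y) − q̃(x)·K(x,y) = ∂²K/∂y²(x,y) − p(y)·K(x,y) for y > x; (ii) q̃(x) = p(x) − 2·(d/dx)K(x,x) for all x; (iii) for every x, K(x,y) → 0 and ∂K/∂y(x,y) → 0 as y → +∞, and for every a ∈ ℝ there is an integrable function h on (a,∞) dominating |K|, |∂K/∂x|, |∂²K/∂x²|, |∂K/∂y| and |∂²K/∂y²| on {(x,y) : y ≥ x ≥ a}. Let z ∈ ℂ and let ψ : ℝ → ℂ be a twice continuously differentiable solution of −ψ'' + p·ψ = z·ψ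 such that ψ and ψ' are bounded on each half-line (a,∞). Then the function φ(x) = ψ(x) + ∫_x^∞ K(x,y)·ψ(y) dy is twice continuously differentiable and satisfies −φ''(x) + q̃(x)·φ(x) = z·φ(x) for all x ∈ ℝ. -/
open MeasureTheory Filter

/-- The partial derivative in the first variable of a jointly differentiable function. -/
lemma hasDerivAt_partial_fst {E : Type*} [NormedAddCommGroup E] [NormedSpace ℝ E]
    {f : ℝ → ℝ → E} (hf : Differentiable ℝ fun q : ℝ × ℝ => f q.1 q.2) (x y : ℝ) :
    HasDerivAt (fun x' => f x' y) (fderiv ℝ (fun q : ℝ × ℝ => f q.1 q.2) (x, y) (1, 0)) x :=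
  HasFDerivAt.comp_hasDerivAt (f := fun x' => (x', y)) x (hf (x, y)).hasFDerivAt
    ((hasDerivAt_id' x).prodMk (hasDerivAt_const x y))

/-- The partial derivative in the second variable of a jointly differentiable function. -/
lemma hasDerivAt_partial_snd {E : Type*} [NormedAddCommGroup E] [NormedSpace ℝ E]
    {f : ℝ → ℝ → E} (hf : Differentiable ℝ fun q : ℝ × ℝ => f q.1 q.2) (x y : ℝ) :
    HasDerivAt (fun y' => f x y') (fderiv ℝ (fun q : ℝ × ℝ => f q.1 q.2) (x, y) (0, 1)) y :=
  HasFDerivAt.comp_hasDerivAt (f := fun y' => (x, y')) y (hf (x, y)).hasFDerivAt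
    ((hasDerivAt_const y x).prodMk (hasDerivAt_id' y))

lemma hasDerivAt_diag {E : Type*} [NormedAddCommGroup E] [NormedSpace ℝ E]
    {f : ℝ → ℝ → E} (hf : Differentiable ℝ fun q : ℝ × ℝ => f q.1 q.2) (x : ℝ) :
    HasDerivAt (fun t => f t t)
      (deriv (fun x' => f x' x) x + deriv (fun y' => f x y') x) x := by
  rw [(hasDerivAt_partial_fst hf x x).deriv, (hasDerivAt_partial_snd hf x x).deriv, ← map_add]
  refine (HasFDerivAt.comp_hasDerivAt (f := fun t => (t, t)) x (hf (x, x)).hasFDerivAt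
    ((hasDerivAt_id' x).prodMk (hasDerivAt_id' x))).congr_deriv ?_
  simp

lemma contDiff_partial_fst {E : Type*} [NormedAddCommGroup E] [NormedSpace ℝ E]
    {f : ℝ → ℝ → E} {m n : ℕ∞} (hf : ContDiff ℝ n fun q : ℝ × ℝ => f q.1 q.2)
    (hmn : m + 1 ≤ n) :
    ContDiff ℝ m fun q : ℝ × ℝ => deriv (fun x' => f x' q.2) q.1 := by
  have hmn' : (m : WithTop ℕ∞) + 1 ≤ n := by exact_mod_cast hmn
  have hd : Differentiable ℝ fun q : ℝ × ℝ => f q.1 q.2 :=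
    (hf.of_le (le_trans le_add_self hmn')).differentiable one_ne_zero
  simp_rw [fun q : ℝ × ℝ => (hasDerivAt_partial_fst hd q.1 q.2).deriv]
  exact (hf.fderiv_right hmn').clm_apply contDiff_const

lemma contDiff_partial_snd {E : Type*} [NormedAddCommGroup E] [NormedSpace ℝ E]
    {f : ℝ → ℝ → E} {m n : ℕ∞} (hf : ContDiff ℝ n fun q : ℝ × ℝ => f q.1 q.2)
    (hmn : m + 1 ≤ n) :
    ContDiff ℝ m fun q : ℝ × ℝ => deriv (fun y' => f q.1 y') q.2 := by
  have hmn' : (m : WithTop ℕ∞) + 1 ≤ n := by exact_mod_cast hmn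
  have hd : Differentiable ℝ fun q : ℝ × ℝ => f q.1 q.2 :=
    (hf.of_le (le_trans le_add_self hmn')).differentiable one_ne_zero
  simp_rw [fun q : ℝ × ℝ => (hasDerivAt_partial_snd hd q.1 q.2).deriv]
  exact (hf.fderiv_right hmn').clm_apply contDiff_const

/-- The contribution of the moving end point in the Leibniz rule. -/
lemma hasDerivAt_intervalIntegral_moving_endpoint {E : Type*} [NormedAddCommGroup E]
    [NormedSpace ℝ E] [CompleteSpace E] {F : ℝ → ℝ → E}
    (hF : Continuous fun q : ℝ × ℝ => F q.1 q.2) (x₀ : ℝ) :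
    HasDerivAt (fun x => ∫ y in x₀..x, F x y) (F x₀ x₀) x₀ := by
  rw [hasDerivAt_iff_isLittleO, Asymptotics.isLittleO_iff]
  intro c hc
  obtain ⟨δ, hδ, hball⟩ := Metric.continuousAt_iff.1 (hF.continuousAt (x := (x₀, x₀))) c hc
  filter_upwards [Metric.ball_mem_nhds x₀ hδ] with x hx
  have hFint : IntervalIntegrable (fun y => F x y) volume x₀ x :=
    (hF.comp (Continuous.prodMk_right x)).intervalIntegrable _ _
  have hsub : (∫ y in x₀..x, F x y) - (∫ y in x₀..x₀, F x₀ y) - (x - x₀) • F x₀ x₀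
      = ∫ y in x₀..x, (F x y - F x₀ x₀) := by
    rw [intervalIntegral.integral_sub hFint intervalIntegrable_const,
      intervalIntegral.integral_const, intervalIntegral.integral_same, sub_zero]
  rw [hsub, Real.norm_eq_abs]
  refine intervalIntegral.norm_integral_le_of_norm_le_const fun y hy => ?_
  have hy' : dist y x₀ < δ := by
    rw [Real.dist_eq]
    refine lt_of_le_of_lt ?_ (Real.dist_eq x x₀ ▸ Metric.mem_ball.1 hx)
    exact Set.abs_sub_left_of_mem_uIcc (Set.uIoc_subset_uIcc hy)
  have := @hball (x, y) (by rw [Prod.dist_eq]; exact max_lt hx hy')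
  rw [dist_eq_norm] at this
  exact this.le

/-- Leibniz rule for `∫_x^∞ F(x,y) dy` under a domination on `{a ≤ x ≤ y}`. -/
lemma hasDerivAt_integral_Ioi_param {E : Type*} [NormedAddCommGroup E]
    [NormedSpace ℝ E] [CompleteSpace E] {F F' : ℝ → ℝ → E}
    (hF : Continuous fun q : ℝ × ℝ => F q.1 q.2)
    (hF' : Continuous fun q : ℝ × ℝ => F' q.1 q.2)
    (hderiv : ∀ x y, HasDerivAt (fun x' => F x' y) (F' x y) x)
    {a x₀ : ℝ} (hax : a < x₀) {h : ℝ → ℝ} (hh : IntegrableOn h (Set.Ioi a))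
    (hFh : ∀ x y, a ≤ x → x ≤ y → ‖F x y‖ ≤ h y)
    (hFh' : ∀ x y, a ≤ x → x ≤ y → ‖F' x y‖ ≤ h y) :
    HasDerivAt (fun x => ∫ y in Set.Ioi x, F x y)
      (-F x₀ x₀ + ∫ y in Set.Ioi x₀, F' x₀ y) x₀ := by
  have hFint : ∀ x ≥ a, IntegrableOn (F x) (Set.Ioi x) := fun x hx =>
    Integrable.mono' (hh.mono_set (Set.Ioi_subset_Ioi hx))
      (hF.comp (Continuous.prodMk_right x)).aestronglyMeasurable
      ((ae_restrict_iff' measurableSet_Ioi).2 <| ae_of_all _ fun y hy => hFh x y hx (le_of_lt hy))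
  have hii : ∀ x u v, IntervalIntegrable (F x) volume u v := fun x u v =>
    (hF.comp (Continuous.prodMk_right x)).intervalIntegrable _ _
  have hFint' : ∀ x ≥ a, IntegrableOn (F x) (Set.Ioi x₀) := fun x hx => by
    rcases le_total x x₀ with h1 | h1
    · exact (hFint x hx).mono_set (Set.Ioi_subset_Ioi h1)
    · rw [← Set.Ioc_union_Ioi_eq_Ioi h1]
      exact ((intervalIntegrable_iff_integrableOn_Ioc_of_le h1).1 (hii x _ _)).union (hFint x hx)
  obtain ⟨C, hC⟩ := (isCompact_Icc.prod isCompact_Icc :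
    IsCompact (Set.Icc a (x₀ + 1) ×ˢ Set.Icc x₀ (x₀ + 1))).exists_bound_of_continuousOn
      hF'.continuousOn
  have hC0 : 0 ≤ C := (norm_nonneg _).trans
    (hC (x₀, x₀) ⟨⟨hax.le, by linarith⟩, ⟨le_rfl, by linarith⟩⟩)
  have hfixed : HasDerivAt (fun x => ∫ y in Set.Ioi x₀, F x y)
      (∫ y in Set.Ioi x₀, F' x₀ y) x₀ := by
    refine (hasDerivAt_integral_of_dominated_loc_of_deriv_le
      (bound := fun y => (Set.Iic (x₀ + 1)).indicator (fun _ => C) y + h y)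
      (Ioo_mem_nhds hax (lt_add_one x₀)) ?_ (hFint' x₀ hax.le) ?_ ?_ ?_ ?_).2
    · exact Eventually.of_forall fun x =>
        (hF.comp (Continuous.prodMk_right x)).aestronglyMeasurable
    · exact (hF'.comp (Continuous.prodMk_right x₀)).aestronglyMeasurable
    · refine (ae_restrict_iff' measurableSet_Ioi).2 <| ae_of_all _ fun y hy x hx => ?_
      have hy : x₀ < y := hy
      have h0 : 0 ≤ h y := (norm_nonneg _).trans (hFh x₀ y hax.le hy.le)
      by_cases hyb : y ≤ x₀ + 1
      · rw [Set.indicator_of_mem (show y ∈ Set.Iic (x₀ + 1) from hyb)]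
        have := hC (x, y) ⟨⟨hx.1.le, hx.2.le⟩, ⟨hy.le, hyb⟩⟩
        simp only at this
        linarith
      · rw [Set.indicator_of_notMem (show y ∉ Set.Iic (x₀ + 1) from hyb), zero_add]
        exact hFh' x y hx.1.le (hx.2.le.trans (not_le.1 hyb).le)
    · refine Integrable.add ?_ (hh.mono_set (Set.Ioi_subset_Ioi hax.le))
      rw [integrable_indicator_iff measurableSet_Iic]
      refine integrableOn_const ?_
      rw [Measure.restrict_apply measurableSet_Iic, Set.inter_comm, Set.Ioi_inter_Iic]
      exact measure_Ioc_lt_top.ne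
    · exact ae_of_all _ fun y x _ => hderiv x y
  have hsub := hfixed.sub (hasDerivAt_intervalIntegral_moving_endpoint hF x₀)
  rw [neg_add_eq_sub]
  refine hsub.congr_of_eventuallyEq ?_
  filter_upwards [Ioi_mem_nhds hax] with x hx
  have hx : a < x := hx
  simp only [Pi.sub_apply]
  rw [eq_sub_iff_add_eq', intervalIntegral.integral_interval_add_Ioi (hFint' x hx.le)
    (hFint x hx.le)]

/-- The transformation-operator mechanism of Lemma 5.7: if the kernel `K` satisfies the
Goursat-type wave equation with boundary condition `q̃(x) = p(x) − 2·(d/dx)K(x,x)`,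
decays together with its `y`-derivative as `y → +∞`, and is dominated (together with
its first and second partial derivatives) by an integrable function, then
`φ(x) = ψ(x) + ∫_x^∞ K(x,y)·ψ(y) dy` maps bounded solutions `ψ` of the background
Schrödinger equation with potential `p` to solutions of the equation with the
reconstructed potential `q̃`, for every spectral parameter `z`. -/
theorem transformation_operator_maps_solutions
    (p qt : ℝ → ℝ) (hp : Continuous p) (hqt : Continuous qt)
    (K : ℝ → ℝ → ℝ)
    (hK : ContDiff ℝ 2 fun pt : ℝ × ℝ => K pt.1 pt.2)
    (hwave : ∀ x y : ℝ, x < y →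
      deriv (deriv fun x' => K x' y) x - qt x * K x y =
        deriv (deriv fun y' => K x y') y - p y * K x y)
    (hdiag : ∀ x : ℝ, qt x = p x - 2 * deriv (fun t : ℝ => K t t) x)
    (hdecay : ∀ x : ℝ,
      Tendsto (fun y => K x y) atTop (nhds 0) ∧
      Tendsto (fun y => deriv (fun y' => K x y') y) atTop (nhds 0))
    (hdom : ∀ a : ℝ, ∃ h : ℝ → ℝ, IntegrableOn h (Set.Ioi a) ∧
      ∀ x y : ℝ, a ≤ x → x ≤ y →
        |K x y| ≤ h y ∧
        |deriv (fun x' => K x' y) x| ≤ h y ∧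
        |deriv (deriv fun x' => K x' y) x| ≤ h y ∧
        |deriv (fun y' => K x y') y| ≤ h y ∧
        |deriv (deriv fun y' => K x y') y| ≤ h y)
    (z : ℂ) (ψ : ℝ → ℂ) (hψ : ContDiff ℝ 2 ψ)
    (hψeq : ∀ x : ℝ, -(deriv (deriv ψ) x) + (p x : ℂ) * ψ x = z * ψ x)
    (hψbd : ∀ a : ℝ, ∃ M : ℝ, ∀ x : ℝ, a ≤ x → ‖ψ x‖ ≤ M ∧ ‖deriv ψ x‖ ≤ M) :
    ContDiff ℝ 2 (fun x : ℝ => ψ x + ∫ y in Set.Ioi x, (K x y : ℂ) * ψ y) ∧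
    ∀ x : ℝ,
      -(deriv (deriv fun x' : ℝ => ψ x' + ∫ y in Set.Ioi x', (K x' y : ℂ) * ψ y) x)
          + (qt x : ℂ) * (ψ x + ∫ y in Set.Ioi x, (K x y : ℂ) * ψ y)
        = z * (ψ x + ∫ y in Set.Ioi x, (K x y : ℂ) * ψ y) := by
  have hKd : Differentiable ℝ fun q : ℝ × ℝ => K q.1 q.2 := hK.differentiable two_ne_zero
  have hK1 : ContDiff ℝ 1 fun q : ℝ × ℝ => deriv (fun x' => K x' q.2) q.1 :=
    contDiff_partial_fst (m := 1) (n := 2) hK (by norm_num)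
  have hK2 : ContDiff ℝ 1 fun q : ℝ × ℝ => deriv (fun y' => K q.1 y') q.2 :=
    contDiff_partial_snd (m := 1) (n := 2) hK (by norm_num)
  have hK11 : Continuous fun q : ℝ × ℝ => deriv (deriv fun x' => K x' q.2) q.1 :=
    (contDiff_partial_fst (f := fun x y => deriv (fun x' => K x' y) x) (m := 0) (n := 1) hK1
      (by norm_num)).continuous
  have hK22 : Continuous fun q : ℝ × ℝ => deriv (deriv fun y' => K q.1 y') q.2 :=
    (contDiff_partial_snd (f := fun x y => deriv (fun y' => K x y') y) (m := 0) (n := 1) hK2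
      (by norm_num)).continuous
  have dK1 : ∀ x y, HasDerivAt (fun x' => K x' y) (deriv (fun x' => K x' y) x) x := fun x y =>
    (hasDerivAt_partial_fst hKd x y).differentiableAt.hasDerivAt
  have dK2 : ∀ x y, HasDerivAt (fun y' => K x y') (deriv (fun y' => K x y') y) y := fun x y =>
    (hasDerivAt_partial_snd hKd x y).differentiableAt.hasDerivAt
  have dK11 : ∀ x y, HasDerivAt (deriv fun x' => K x' y) (deriv (deriv fun x' => K x' y) x) x :=
    fun x y => (hasDerivAt_partial_fst (f := fun x y => deriv (fun x' => K x' y) x)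
      (hK1.differentiable one_ne_zero) x y).differentiableAt.hasDerivAt
  have dK22 : ∀ x y, HasDerivAt (deriv fun y' => K x y') (deriv (deriv fun y' => K x y') y) y :=
    fun x y => (hasDerivAt_partial_snd (f := fun x y => deriv (fun y' => K x y') y)
      (hK2.differentiable one_ne_zero) x y).differentiableAt.hasDerivAt
  have dψ : ∀ x, HasDerivAt ψ (deriv ψ x) x := fun x =>
    (hψ.differentiable two_ne_zero x).hasDerivAt
  have hψ' : ContDiff ℝ 1 (deriv ψ) := (contDiff_succ_iff_deriv.1 hψ).2.2
  have dψ' : ∀ x, HasDerivAt (deriv ψ) (deriv (deriv ψ) x) x := fun x =>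
    (hψ'.differentiable one_ne_zero x).hasDerivAt
  have cmul : ∀ {k : ℝ → ℝ → ℝ}, Continuous (fun q : ℝ × ℝ => k q.1 q.2) →
      Continuous fun q : ℝ × ℝ => (k q.1 q.2 : ℂ) * ψ q.2 := fun hk =>
    (Complex.continuous_ofReal.comp hk).mul (hψ.continuous.comp continuous_snd)
  -- a common integrable majorant for the products of the kernels with `ψ`
  have hdomψ : ∀ a : ℝ, ∃ g : ℝ → ℝ, IntegrableOn g (Set.Ioi a) ∧
      ∀ x y : ℝ, a ≤ x → x ≤ y →
        ‖(K x y : ℂ) * ψ y‖ ≤ g y ∧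
        ‖((deriv (fun x' => K x' y) x : ℝ) : ℂ) * ψ y‖ ≤ g y ∧
        ‖((deriv (deriv fun x' => K x' y) x : ℝ) : ℂ) * ψ y‖ ≤ g y := by
    intro a
    obtain ⟨h, hh, hle⟩ := hdom a
    obtain ⟨M, hM⟩ := hψbd a
    refine ⟨fun y => h y * M, Integrable.mul_const hh M, fun x y hx hy => ?_⟩
    obtain ⟨h0, h1, h2, -, -⟩ := hle x y hx hy
    have hψy := (hM y (hx.trans hy)).1
    have hpos : 0 ≤ h y := (abs_nonneg _).trans h0
    simp only [norm_mul, Complex.norm_real, Real.norm_eq_abs]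
    exact ⟨by gcongr, by gcongr, by gcongr⟩
  have hFint : ∀ {k : ℝ → ℝ → ℝ} (x : ℝ) {g : ℝ → ℝ},
      Continuous (fun q : ℝ × ℝ => k q.1 q.2) → IntegrableOn g (Set.Ioi x) →
      (∀ y, x ≤ y → ‖(k x y : ℂ) * ψ y‖ ≤ g y) →
      IntegrableOn (fun y => (k x y : ℂ) * ψ y) (Set.Ioi x) := fun x g hk hg hle =>
    Integrable.mono' hg ((cmul hk).comp (Continuous.prodMk_right x)).aestronglyMeasurable
      ((ae_restrict_iff' measurableSet_Ioi).2 <| ae_of_all _ fun y hy => hle y (le_of_lt hy))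
  set I : ℝ → ℂ := fun x => ∫ y in Set.Ioi x, (K x y : ℂ) * ψ y with hI
  set J : ℝ → ℂ :=
    fun x => ∫ y in Set.Ioi x, ((deriv (fun x' => K x' y) x : ℝ) : ℂ) * ψ y
  set L : ℝ → ℂ :=
    fun x => ∫ y in Set.Ioi x, ((deriv (deriv fun x' => K x' y) x : ℝ) : ℂ) * ψ y with hL
  have dI : ∀ x, HasDerivAt I (-((K x x : ℂ) * ψ x) + J x) x := fun x => by
    obtain ⟨g, hg, hle⟩ := hdomψ (x - 1)
    exact hasDerivAt_integral_Ioi_param (F := fun x y => (K x y : ℂ) * ψ y)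
      (F' := fun x y => ((deriv (fun x' => K x' y) x : ℝ) : ℂ) * ψ y)
      (cmul hK.continuous) (cmul (k := fun x y => deriv (fun x' => K x' y) x) hK1.continuous)
      (fun x y => (dK1 x y).ofReal_comp.mul_const _) (sub_one_lt x) hg
      (fun x y hx hy => (hle x y hx hy).1) (fun x y hx hy => (hle x y hx hy).2.1)
  have dJ : ∀ x, HasDerivAt J
      (-(((deriv (fun x' => K x' x) x : ℝ) : ℂ) * ψ x) + L x) x := fun x => by
    obtain ⟨g, hg, hle⟩ := hdomψ (x - 1)
    exact hasDerivAt_integral_Ioi_param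
      (F := fun x y => ((deriv (fun x' => K x' y) x : ℝ) : ℂ) * ψ y)
      (F' := fun x y => ((deriv (deriv fun x' => K x' y) x : ℝ) : ℂ) * ψ y)
      (cmul (k := fun x y => deriv (fun x' => K x' y) x) hK1.continuous)
      (cmul (k := fun x y => deriv (deriv fun x' => K x' y) x) hK11)
      (fun x y => (dK11 x y).ofReal_comp.mul_const _) (sub_one_lt x) hg
      (fun x y hx hy => (hle x y hx hy).2.1) (fun x y hx hy => (hle x y hx hy).2.2)
  -- Green's identity on `(x, ∞)`
  have hgreen : ∀ x, L x = ((qt x : ℂ) - z) * I x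
      - (((deriv (fun y' => K x y') x : ℝ) : ℂ) * ψ x - (K x x : ℂ) * deriv ψ x) := fun x => by
    obtain ⟨g, hg, hle⟩ := hdomψ x
    have i0 : IntegrableOn (fun y => (K x y : ℂ) * ψ y) (Set.Ioi x) :=
      hFint x hK.continuous hg fun y hy => (hle x y le_rfl hy).1
    have i2 : IntegrableOn (fun y => ((deriv (deriv fun x' => K x' y) x : ℝ) : ℂ) * ψ y)
        (Set.Ioi x) :=
      hFint (k := fun x y => deriv (deriv fun x' => K x' y) x) x hK11 hg
        fun y hy => (hle x y le_rfl hy).2.2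
    have hW : ∀ y, HasDerivAt
        (fun y => ((deriv (fun y' => K x y') y : ℝ) : ℂ) * ψ y - (K x y : ℂ) * deriv ψ y)
        (((deriv (deriv fun y' => K x y') y : ℝ) : ℂ) * ψ y
          - (K x y : ℂ) * deriv (deriv ψ) y) y := fun y => by
      refine (((dK22 x y).ofReal_comp.mul (dψ y)).sub
        ((dK2 x y).ofReal_comp.mul (dψ' y))).congr_deriv ?_
      ring
    have heq : Set.EqOn
        (fun y => ((deriv (deriv fun x' => K x' y) x : ℝ) : ℂ) * ψ y
          - ((qt x : ℂ) - z) * ((K x y : ℂ) * ψ y))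
        (fun y => ((deriv (deriv fun y' => K x y') y : ℝ) : ℂ) * ψ y
          - (K x y : ℂ) * deriv (deriv ψ) y) (Set.Ioi x) := fun y hy => by
      have h1 : ((deriv (deriv fun x' => K x' y) x : ℝ) : ℂ) - qt x * K x y =
          ((deriv (deriv fun y' => K x y') y : ℝ) : ℂ) - p y * K x y := by
        exact_mod_cast hwave x y hy
      simp only
      linear_combination ψ y * h1 - (K x y : ℂ) * hψeq y
    have i3 := i2.sub (i0.const_mul ((qt x : ℂ) - z))
    obtain ⟨M, hM⟩ := hψbd x
    have hbd : ∀ f : ℝ → ℂ, (∀ y, x ≤ y → ‖f y‖ ≤ M) →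
        IsBoundedUnder (· ≤ ·) atTop (norm ∘ f) := fun f hf =>
      isBoundedUnder_of_eventually_le (a := M) ((eventually_ge_atTop x).mono hf)
    have hof : ∀ {k : ℝ → ℝ}, Tendsto k atTop (nhds 0) →
        Tendsto (fun y => (k y : ℂ)) atTop (nhds 0) := fun hk => by
      rw [← Complex.ofReal_zero]
      exact (Complex.continuous_ofReal.tendsto 0).comp hk
    have hlim : Tendsto
        (fun y => ((deriv (fun y' => K x y') y : ℝ) : ℂ) * ψ y - (K x y : ℂ) * deriv ψ y)
        atTop (nhds 0) := by
      rw [← sub_zero (0 : ℂ)]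
      exact ((hof (hdecay x).2).zero_mul_isBoundedUnder_le (hbd _ fun y hy => (hM y hy).1)).sub
        ((hof (hdecay x).1).zero_mul_isBoundedUnder_le (hbd _ fun y hy => (hM y hy).2))
    have hftc := integral_Ioi_of_hasDerivAt_of_tendsto' (a := x) (fun y _ => hW y)
      ((integrableOn_congr_fun heq measurableSet_Ioi).1 i3) hlim
    rw [← setIntegral_congr_fun measurableSet_Ioi heq,
      integral_sub i2 (i0.const_mul _), integral_const_mul] at hftc
    simp only [hL, hI]
    linear_combination hftc
  have dφ : ∀ x, HasDerivAt (fun x => ψ x + I x)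
      (deriv ψ x + (-((K x x : ℂ) * ψ x) + J x)) x := fun x => (dψ x).add (dI x)
  have hφ' : deriv (fun x => ψ x + I x)
      = fun x => deriv ψ x + (-((K x x : ℂ) * ψ x) + J x) := funext fun x => (dφ x).deriv
  have dφ' : ∀ x, HasDerivAt (deriv fun x => ψ x + I x)
      (((qt x : ℂ) - z) * (ψ x + I x)) x := fun x => by
    rw [hφ']
    have hd := hasDerivAt_diag hKd x
    have hq : (qt x : ℂ) = p x - 2 * (((deriv (fun x' => K x' x) x : ℝ) : ℂ)
        + ((deriv (fun y' => K x y') x : ℝ) : ℂ)) := by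
      rw [hdiag x, hd.deriv]
      push_cast
      ring
    refine ((dψ' x).add ((hd.ofReal_comp.mul (dψ x)).neg.add (dJ x))).congr_deriv ?_
    rw [hgreen x]
    push_cast
    linear_combination -ψ x * hq - hψeq x
  have hφ'' : deriv (deriv fun x => ψ x + I x) = fun x => ((qt x : ℂ) - z) * (ψ x + I x) :=
    funext fun x => (dφ' x).deriv
  have hφd : Differentiable ℝ fun x => ψ x + I x := fun x => (dφ x).differentiableAt
  refine ⟨?_, fun x => ?_⟩
  · refine contDiff_succ_iff_deriv (n := 1).2 ⟨hφd, by simp, contDiff_one_iff_deriv.2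
      ⟨fun x => (dφ' x).differentiableAt, ?_⟩⟩
    rw [hφ'']
    exact ((Complex.continuous_ofReal.comp hqt).sub continuous_const).mul hφd.continuous
  · rw [(dφ' x).deriv]
    ring
end
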